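/- arXiv:1009.0564 — 3 statements merged into one kernel-verified Lean document; each statement's English description precedes it below -/
import Mathlib

section
/- Let I ⊂ ℝ be a nonempty open interval and 0 < a < b. Let v : I × (a,b) × (ℝ³ \ {0}) → ℂ be smooth and satisfy v(t,r,λω) = v(t,r,ω) for all λ > 0 (so v depends on its third argument only through its direction, i.e. v is a smooth function of (t,r,ω) with ω in the unit sphere S²). Assume that for every fixed ω ∈ S² the function (t,x) ↦ v(t,|x|,ω) satisfies the wave equation ∂²ₜu − Δₓu = 0 on the region {(t,x) : t ∈ I, a < |x| < b}. Then the function u(t,x) := v(t,|x|, x/|x|) satisfies the wave equation ∂²ₜu − Δₓu = 0 on {(t,x) : t ∈ I, a < |x| < b} if and only if v is independent of its angular argument, i.e. v(t,r,ω) = v(t,r,ω′) for all t ∈ I, r ∈ (a,b) and all ω, ω′ ∈ S². -/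
noncomputable section

open Real Set MeasureTheory

/-- Three dimensional Euclidean space. -/
abbrev R3 : Type := EuclideanSpace ℝ (Fin 3)

/-- The vector `(1,0,0)`. -/
def e1 : R3 := EuclideanSpace.single 0 1

/-- The cross product on `ℝ³`. -/
def cross3 (u v : R3) : R3 :=
  (WithLp.equiv 2 (Fin 3 → ℝ)).symm
    ![u 1 * v 2 - u 2 * v 1, u 2 * v 0 - u 0 * v 2, u 0 * v 1 - u 1 * v 0]

/-- Partial derivative in the `i`-th coordinate direction. -/
def pd {E : Type*} [NormedAddCommGroup E] [NormedSpace ℝ E]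
    (i : Fin 3) (f : R3 → E) (x : R3) : E :=
  fderiv ℝ f x (EuclideanSpace.single i 1)

/-- The curl of a vector field on `ℝ³`. -/
def curl3 (F : R3 → R3) (x : R3) : R3 :=
  (WithLp.equiv 2 (Fin 3 → ℝ)).symm
    ![pd 1 (fun y => F y 2) x - pd 2 (fun y => F y 1) x,
      pd 2 (fun y => F y 0) x - pd 0 (fun y => F y 2) x,
      pd 0 (fun y => F y 1) x - pd 1 (fun y => F y 0) x]

/-- The divergence of a vector field on `ℝ³`. -/
def div3 (F : R3 → R3) (x : R3) : ℝ :=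
  pd 0 (fun y => F y 0) x + pd 1 (fun y => F y 1) x + pd 2 (fun y => F y 2) x

/-- The wave operator `□u = ∂ₜ²u − Δₓu` applied to a function `u : ℝ × ℝ³ → ℂ`
(written in curried form), evaluated at `(t,x)`. -/
def waveOp (u : ℝ → R3 → ℂ) (t : ℝ) (x : R3) : ℂ :=
  deriv (fun s => deriv (fun s' => u s' x) s) t
    - (pd 0 (fun y => pd 0 (fun z => u t z) y) x
       + pd 1 (fun y => pd 1 (fun z => u t z) y) x
       + pd 2 (fun y => pd 2 (fun z => u t z) y) x)

noncomputable section LaplacianLemmas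

open Topology

/-- The Euclidean Laplacian on `ℝ³`, as it occurs in `waveOp`. -/
def lap3 {E : Type*} [NormedAddCommGroup E] [NormedSpace ℝ E] (f : R3 → E) (x : R3) : E :=
  pd 0 (fun y => pd 0 f y) x + pd 1 (fun y => pd 1 f y) x + pd 2 (fun y => pd 2 f y) x

lemma clm_apply_eq_sum {E : Type*} [NormedAddCommGroup E] [NormedSpace ℝ E]
    (L : R3 →L[ℝ] E) (x : R3) :
    L x = x 0 • L (EuclideanSpace.single 0 1) + x 1 • L (EuclideanSpace.single 1 1)
      + x 2 • L (EuclideanSpace.single 2 1) := by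
  have hx : x = x 0 • EuclideanSpace.single (0 : Fin 3) (1 : ℝ)
      + x 1 • EuclideanSpace.single (1 : Fin 3) (1 : ℝ)
      + x 2 • EuclideanSpace.single (2 : Fin 3) (1 : ℝ) := by
    ext i
    fin_cases i <;> simp
  conv_lhs => rw [hx]
  simp only [map_add, map_smul]

lemma inner_single_one (x : R3) (i : Fin 3) :
    inner ℝ x (EuclideanSpace.single i (1 : ℝ)) = x i := by
  simp [EuclideanSpace.inner_single_right]

lemma pd_congr {E : Type*} [NormedAddCommGroup E] [NormedSpace ℝ E] {f g : R3 → E} {x : R3}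
    (h : f =ᶠ[𝓝 x] g) (i : Fin 3) : pd i f =ᶠ[𝓝 x] pd i g := by
  filter_upwards [h.fderiv (𝕜 := ℝ)] with y hy
  simp only [pd, hy]

lemma lap3_congr {E : Type*} [NormedAddCommGroup E] [NormedSpace ℝ E] {f g : R3 → E} {x : R3}
    (h : f =ᶠ[𝓝 x] g) : lap3 f x = lap3 g x := by
  have key (i : Fin 3) : pd i (fun y => pd i f y) x = pd i (fun y => pd i g y) x :=
    (pd_congr (pd_congr h i) i).eq_of_nhds
  simp only [lap3, key]

lemma waveOp_eq (u : ℝ → R3 → ℂ) (t : ℝ) (x : R3) :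
    waveOp u t x = deriv (fun s => deriv (fun s' => u s' x) s) t - lap3 (u t) x := rfl

/-- Second directional derivative of a composition with an affine map. -/
lemma pd_pd_comp {G E : Type*} [NormedAddCommGroup G] [NormedSpace ℝ G]
    [NormedAddCommGroup E] [NormedSpace ℝ E] {W : G → E} {A : R3 → G} {L : R3 →L[ℝ] G}
    (hA : ∀ y, HasFDerivAt A L y) {x : R3} (hW : ContDiffAt ℝ 2 W (A x)) (i : Fin 3) :
    pd i (fun y => pd i (fun z => W (A z)) y) x =
      fderiv ℝ (fderiv ℝ W) (A x) (L (EuclideanSpace.single i 1))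
        (L (EuclideanSpace.single i 1)) := by
  have hev : ∀ᶠ y in 𝓝 x, ContDiffAt ℝ 2 W (A y) :=
    (hA x).continuousAt.eventually (hW.eventually (by simp))
  have h1 : (fun y => pd i (fun z => W (A z)) y) =ᶠ[𝓝 x]
      fun y => fderiv ℝ W (A y) (L (EuclideanSpace.single i 1)) := by
    filter_upwards [hev] with y hy
    have := (hy.differentiableAt (by simp)).hasFDerivAt.comp y (hA y)
    simp only [pd]
    rw [show (fun z => W (A z)) = W ∘ A from rfl, this.fderiv]
    rfl
  have h2 : DifferentiableAt ℝ (fderiv ℝ W) (A x) :=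
    (hW.fderiv_right (m := 1) (by norm_num)).differentiableAt (by simp)
  have h3 := (h2.hasFDerivAt.comp x (hA x)).clm_apply
    (hasFDerivAt_const (L (EuclideanSpace.single i (1 : ℝ))) x)
  rw [pd, h1.fderiv_eq]
  have h4 := h3.fderiv
  simp only [Function.comp_def] at h4
  rw [h4]
  simp

/-- For a function `W (y, z)` which is radial in `y` and homogeneous of degree zero in `z`, the
Laplacian of the diagonal restriction `W (x, x)` has no mixed terms. -/
lemma lap3_diagonal {E : Type*} [NormedAddCommGroup E] [NormedSpace ℝ E]
    {W : R3 × R3 → E} {x : R3} (hx : x ≠ 0) (hW : ContDiffAt ℝ 2 W (x, x))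
    (hrad : ∀ᶠ p in 𝓝 (x, x), ∀ h : R3,
      ‖p.1‖ ^ 2 • fderiv ℝ W p (h, 0) = inner ℝ p.1 h • fderiv ℝ W p (p.1, 0))
    (hhom : ∀ᶠ p in 𝓝 (x, x), fderiv ℝ W p (0, p.2) = 0) :
    lap3 (fun y => W (y, y)) x = lap3 (fun y => W (y, x)) x + lap3 (fun z => W (x, z)) x := by
  set D := fderiv ℝ (fderiv ℝ W) (x, x) with hD
  have hdiff : DifferentiableAt ℝ (fderiv ℝ W) (x, x) :=
    (hW.fderiv_right (m := 1) (by norm_num)).differentiableAt (by simp)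
  have hsymm : ∀ p q, D p q = D q p := fun p q =>
    (hW.isSymmSndFDerivAt (by simp)).eq p q
  have hleft : ∀ k, HasFDerivAt (fun y : R3 => (y, k)) (ContinuousLinearMap.inl ℝ R3 R3) x :=
    fun k => hasFDerivAt_prodMk_left x k
  have hright : ∀ k, HasFDerivAt (fun y : R3 => (k, y)) (ContinuousLinearMap.inr ℝ R3 R3) x :=
    fun k => hasFDerivAt_prodMk_right k x
  have hhom' : D (x, 0) (0, x) = 0 := by
    have hev : ∀ᶠ y in 𝓝 x, fderiv ℝ W (y, x) (0, x) = 0 :=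
      ((hleft x).continuousAt (x := x)).eventually hhom
    have h1 : HasFDerivAt (fun y => fderiv ℝ W (y, x) (0, x)) (0 : R3 →L[ℝ] E) x :=
      (hasFDerivAt_const (0 : E) x).congr_of_eventuallyEq hev
    have h2 := (HasFDerivAt.comp x (f := fun y : R3 => (y, x)) hdiff.hasFDerivAt (hleft x)).clm_apply
      (hasFDerivAt_const ((0 : R3), x) x)
    have h3 := congrArg (fun L : R3 →L[ℝ] E => L x) (h2.unique h1)
    simpa using h3
  have hrad' : ∀ k h : R3, ‖x‖ ^ 2 • D (0, k) (h, 0) = inner ℝ x h • D (0, k) (x, 0) := by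
    intro k h
    have hev : ∀ᶠ z in 𝓝 x, ‖x‖ ^ 2 • fderiv ℝ W (x, z) (h, 0)
        = inner ℝ x h • fderiv ℝ W (x, z) (x, 0) := by
      filter_upwards [((hright x).continuousAt (x := x)).eventually hrad] with z hz
      exact hz h
    have h1 := HasFDerivAt.comp x (f := fun y : R3 => (x, y)) hdiff.hasFDerivAt (hright x)
    have h2 := (h1.clm_apply (hasFDerivAt_const (h, (0 : R3)) x)).const_smul (‖x‖ ^ 2)
    have h3 := (h1.clm_apply (hasFDerivAt_const (x, (0 : R3)) x)).const_smul (inner ℝ x h)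
    have h4 := congrArg (fun L : R3 →L[ℝ] E => L k)
      (h2.unique (h3.congr_of_eventuallyEq hev))
    simpa using h4
  have hmixed : D (0, EuclideanSpace.single 0 1) (EuclideanSpace.single 0 1, 0)
      + D (0, EuclideanSpace.single 1 1) (EuclideanSpace.single 1 1, 0)
      + D (0, EuclideanSpace.single 2 1) (EuclideanSpace.single 2 1, 0) = 0 := by
    have hx2 : ‖x‖ ^ 2 ≠ 0 := by positivity
    have h1 := clm_apply_eq_sum
      (((ContinuousLinearMap.apply ℝ E ((x, 0) : R3 × R3)).comp D).comp
        (ContinuousLinearMap.inr ℝ R3 R3)) x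
    simp only [ContinuousLinearMap.comp_apply, ContinuousLinearMap.inr_apply,
      ContinuousLinearMap.apply_apply] at h1
    refine (smul_eq_zero.1 ?_).resolve_left hx2
    rw [smul_add, smul_add, hrad', hrad', hrad', inner_single_one, inner_single_one,
      inner_single_one, ← h1, hsymm, hhom']
  have hd : ∀ y : R3, HasFDerivAt (fun y : R3 => (y, y))
      ((ContinuousLinearMap.id ℝ R3).prod (ContinuousLinearMap.id ℝ R3)) y :=
    fun y => (hasFDerivAt_id y).prodMk (hasFDerivAt_id y)
  have hl : ∀ y : R3, HasFDerivAt (fun y : R3 => (y, x)) (ContinuousLinearMap.inl ℝ R3 R3) y :=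
    fun y => hasFDerivAt_prodMk_left y x
  have hr : ∀ y : R3, HasFDerivAt (fun y : R3 => (x, y)) (ContinuousLinearMap.inr ℝ R3 R3) y :=
    fun y => hasFDerivAt_prodMk_right x y
  have expand : ∀ e : R3, D (e, e) (e, e)
      = D (e, 0) (e, 0) + D (0, e) (0, e) + (2 : ℝ) • D (0, e) (e, 0) := by
    intro e
    have he : ((e, e) : R3 × R3) = (e, 0) + (0, e) := by simp
    rw [he]
    simp only [map_add, add_apply]
    rw [hsymm (e, 0) (0, e), two_smul]
    abel
  simp only [lap3]
  simp only [pd_pd_comp hd hW, pd_pd_comp hl hW, pd_pd_comp hr hW]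
  simp only [← hD, ContinuousLinearMap.prod_apply, ContinuousLinearMap.id_apply,
    ContinuousLinearMap.inl_apply, ContinuousLinearMap.inr_apply, expand]
  have h2 := congrArg (fun w => (2 : ℝ) • w) hmixed
  simp only [smul_add, smul_zero] at h2
  rw [← sub_eq_zero, ← h2]
  abel

/-- Euler's identity for functions which are homogeneous of degree zero. -/
lemma fderiv_self_eq_zero {F E : Type*} [NormedAddCommGroup F] [NormedSpace ℝ F]
    [NormedAddCommGroup E] [NormedSpace ℝ E] {g : F → E} {x : F}
    (hd : DifferentiableAt ℝ g x) (hg : ∀ l : ℝ, 0 < l → g (l • x) = g x) :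
    fderiv ℝ g x x = 0 := by
  have h1 : HasDerivAt (fun l : ℝ => l • x) x 1 := by
    simpa using (hasDerivAt_id (1 : ℝ)).smul_const x
  have h2 : HasFDerivAt g (fderiv ℝ g x) ((1 : ℝ) • x) := by simpa using hd.hasFDerivAt
  have h3 := h2.comp_hasDerivAt 1 h1
  refine h3.unique ((hasDerivAt_const (1 : ℝ) (g x)).congr_of_eventuallyEq ?_)
  filter_upwards [lt_mem_nhds (zero_lt_one : (0 : ℝ) < 1)] with l hl
  exact hg l hl

lemma lap3_smul_of_homogeneous {E : Type*} [NormedAddCommGroup E] [NormedSpace ℝ E]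
    {g : R3 → E} (hg : ∀ x, x ≠ 0 → ∀ l : ℝ, 0 < l → g (l • x) = g x)
    {x : R3} (hx : x ≠ 0) {l : ℝ} (hl : 0 < l) :
    lap3 g x = l ^ 2 • lap3 g (l • x) := by
  have hscale : ∀ (f : R3 → E) (y : R3) (i : Fin 3),
      pd i (fun z => f (l • z)) y = l • pd i f (l • y) := by
    intro f y i
    have := fderiv_comp_smul (𝕜 := ℝ) (f := f) (x := y) l
    simp only [pd, this]
    rfl
  have hev : g =ᶠ[𝓝 x] fun z => g (l • z) := by
    filter_upwards [isOpen_ne.mem_nhds hx] with y hy using (hg y hy l hl).symm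
  have key (i : Fin 3) : pd i (fun y => pd i g y) x
      = l ^ 2 • pd i (fun y => pd i g y) (l • x) := by
    rw [(pd_congr (pd_congr hev i) i).eq_of_nhds]
    simp only [funext fun y => hscale g y i]
    rw [hscale (fun y => l • pd i g y) x i]
    have : (fun y => l • pd i g y) = l • fun y => pd i g y := rfl
    rw [pd, this, fderiv_const_smul_field]
    simp [pd, pow_two, smul_smul]
  simp only [lap3, key, smul_add]

lemma integral_pd_eq_zero {F : R3 → ℝ} (hF : ContDiff ℝ 1 F) (hc : HasCompactSupport F)
    (i : Fin 3) : ∫ x, pd i F x = 0 := by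
  have h := integral_smul_fderiv_eq_neg_fderiv_smul_of_integrable (μ := (volume : Measure R3))
    (f := fun _ : R3 => (1 : ℝ)) (g := F) (v := EuclideanSpace.single i 1)
    (by simp) ?_ ?_ (fun _ _ => differentiableAt_const _)
    (fun x _ => hF.differentiable (by simp) x)
  · simpa [pd] using h
  · simp only [one_smul]
    exact ((hF.continuous_fderiv (by simp)).clm_apply continuous_const).integrable_of_hasCompactSupport
      (hc.fderiv_apply ℝ _)
  · simpa using hF.continuous.integrable_of_hasCompactSupport hc

/-- A real function, homogeneous of degree zero and harmonic away from the origin, has vanishing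
gradient: integrate `div (χ g ∇g) = χ |∇g|²` for a radial cutoff `χ`. -/
lemma pd_eq_zero_of_harmonic_of_homogeneous {g : R3 → ℝ} (hg : ContDiffOn ℝ 2 g {0}ᶜ)
    (hhom : ∀ x, x ≠ 0 → ∀ l : ℝ, 0 < l → g (l • x) = g x)
    (hlap : ∀ x, x ≠ 0 → lap3 g x = 0) {p : R3} (hp : p ≠ 0) (j : Fin 3) : pd j g p = 0 := by
  have hc : 0 < ‖p‖ ^ 2 := by positivity
  let φ : ContDiffBump (‖p‖ ^ 2) := ⟨‖p‖ ^ 2 / 4, ‖p‖ ^ 2 / 2, by positivity, by linarith⟩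
  let χ : R3 → ℝ := fun x => φ (‖x‖ ^ 2)
  have hφ : ContDiff ℝ 2 φ := φ.contDiff
  have hχ : ContDiff ℝ 2 χ := hφ.comp (contDiff_norm_sq ℝ)
  have hχp : χ p = 1 := φ.one_of_mem_closedBall (by simp [φ]; positivity)
  have hχ0 : ∀ x : R3, χ x ≠ 0 → ‖p‖ ^ 2 / 2 ≤ ‖x‖ ^ 2 ∧ ‖x‖ ^ 2 ≤ 2 * ‖p‖ ^ 2 := by
    intro x hx
    have h1 : ‖x‖ ^ 2 ∈ Function.support φ := hx
    rw [φ.support_eq, Metric.mem_ball, Real.dist_eq, abs_lt] at h1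
    simp only [φ] at h1
    constructor <;> linarith [h1.1, h1.2]
  have hnear : χ =ᶠ[𝓝 0] fun _ => 0 := by
    have h1 : ∀ᶠ x : R3 in 𝓝 0, ‖x‖ ^ 2 < ‖p‖ ^ 2 / 2 := by
      refine (by fun_prop : Continuous fun x : R3 => ‖x‖ ^ 2).continuousAt.eventually_lt
        continuousAt_const ?_
      simpa using hc
    filter_upwards [h1] with x hx
    by_contra h
    linarith [(hχ0 x h).1]
  have hcs : HasCompactSupport χ := by
    refine HasCompactSupport.intro (isCompact_closedBall (0 : R3) (2 * ‖p‖)) fun x hx => ?_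
    by_contra h
    have h1 := (hχ0 x h).2
    simp only [Metric.mem_closedBall, dist_zero_right, not_le] at hx
    nlinarith [norm_nonneg p, norm_nonneg x]
  have hgAt : ∀ x, x ≠ 0 → ContDiffAt ℝ 2 g x := fun x hx =>
    hg.contDiffAt (isOpen_compl_singleton.mem_nhds hx)
  have hpdAt : ∀ x, x ≠ 0 → ∀ i, ContDiffAt ℝ 1 (pd i g) x := fun x hx i =>
    ((hgAt x hx).fderiv_right (m := 1) (by norm_num)).clm_apply contDiffAt_const
  let F : Fin 3 → R3 → ℝ := fun i x => χ x * (g x * pd i g x)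
  have hFnear : ∀ i, F i =ᶠ[𝓝 0] fun _ => 0 := fun i => by
    filter_upwards [hnear] with x hx
    simp [F, hx]
  have hF : ∀ i, ContDiff ℝ 1 (F i) := by
    intro i
    rw [contDiff_iff_contDiffAt]
    intro x
    by_cases hx : x = 0
    · subst hx
      exact contDiffAt_const.congr_of_eventuallyEq (hFnear i)
    · exact (hχ.contDiffAt.of_le (by norm_num)).mul
        (((hgAt x hx).of_le (by norm_num)).mul (hpdAt x hx i))
  have hFc : ∀ i, HasCompactSupport (F i) := fun i => hcs.mul_right
  have hpdc : ∀ i, Continuous (pd i (F i)) := fun i =>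
    ((hF i).continuous_fderiv (by simp)).clm_apply continuous_const
  have hpds : ∀ i, HasCompactSupport (pd i (F i)) := fun i => (hFc i).fderiv_apply ℝ _
  have hχd : ∀ x i, pd i χ x = 2 * deriv φ (‖x‖ ^ 2) * x i := by
    intro x i
    have h1 : HasDerivAt φ (deriv φ (‖x‖ ^ 2)) (‖x‖ ^ 2) :=
      (hφ.differentiable (by simp) _).hasDerivAt
    have h2 := h1.comp_hasFDerivAt x (hasStrictFDerivAt_norm_sq x).hasFDerivAt
    have h3 := h2.fderiv
    simp only [Function.comp_def] at h3
    simp only [pd, χ]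
    rw [h3]
    simp [inner_single_one]
    ring
  have hdiv : ∀ x, pd 0 (F 0) x + pd 1 (F 1) x + pd 2 (F 2) x
      = χ x * (pd 0 g x ^ 2 + pd 1 g x ^ 2 + pd 2 g x ^ 2) := by
    intro x
    by_cases hx : x = 0
    · subst hx
      have h0 : ∀ i, pd i (F i) 0 = 0 := fun i => by
        rw [(pd_congr (hFnear i) i).eq_of_nhds]
        simp [pd]
      simp [h0, hnear.eq_of_nhds]
    · have hprod : ∀ i, pd i (F i) x = pd i χ x * (g x * pd i g x)
          + χ x * (pd i g x ^ 2 + g x * pd i (fun y => pd i g y) x) := by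
        intro i
        have h1 := (hχ.differentiable (by simp) x).hasFDerivAt
        have h2 := ((hgAt x hx).differentiableAt (by simp)).hasFDerivAt
        have h3 := ((hpdAt x hx i).differentiableAt (by simp)).hasFDerivAt
        have h4 := (h1.mul (h2.mul h3)).fderiv
        have h5 : pd i (F i) x = fderiv ℝ (χ * (g * pd i g)) x (EuclideanSpace.single i 1) := rfl
        rw [h5, h4]
        change χ x * (g x * pd i (pd i g) x + pd i g x * pd i g x)
          + g x * pd i g x * pd i χ x = _
        ring
      have heuler := fderiv_self_eq_zero ((hgAt x hx).differentiableAt (by simp)) (hhom x hx)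
      rw [clm_apply_eq_sum] at heuler
      have hl := hlap x hx
      simp only [lap3] at hl
      rw [hprod, hprod, hprod, hχd, hχd, hχd]
      simp only [smul_eq_mul] at heuler
      change x 0 * pd 0 g x + x 1 * pd 1 g x + x 2 * pd 2 g x = 0 at heuler
      linear_combination (2 * deriv φ (‖x‖ ^ 2) * g x) * heuler + χ x * g x * hl
  by_contra hne
  have hsum : ∫ x, (pd 0 (F 0) x + pd 1 (F 1) x + pd 2 (F 2) x) = 0 := by
    have hi : ∀ i, Integrable (pd i (F i)) := fun i =>
      (hpdc i).integrable_of_hasCompactSupport (hpds i)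
    rw [integral_add (f := fun x => pd 0 (F 0) x + pd 1 (F 1) x) ((hi 0).add (hi 1)) (hi 2),
      integral_add (hi 0) (hi 1),
      integral_pd_eq_zero (hF 0) (hFc 0), integral_pd_eq_zero (hF 1) (hFc 1),
      integral_pd_eq_zero (hF 2) (hFc 2)]
    simp
  have hpos : 0 < ∫ x, (pd 0 (F 0) x + pd 1 (F 1) x + pd 2 (F 2) x) := by
    refine Continuous.integral_pos_of_hasCompactSupport_nonneg_nonzero (x := p)
      (((hpdc 0).add (hpdc 1)).add (hpdc 2)) (((hpds 0).add (hpds 1)).add (hpds 2)) ?_ ?_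
    · intro x
      simp only [hdiv, Pi.zero_apply]
      exact mul_nonneg φ.nonneg (by positivity)
    · simp only [hdiv, hχp, one_mul]
      have h1 : 0 < pd j g p ^ 2 := by positivity
      have h2 : 0 < pd 0 g p ^ 2 + pd 1 g p ^ 2 + pd 2 g p ^ 2 := by
        fin_cases j <;> simp at h1 <;> positivity
      exact h2.ne'
  exact hpos.ne' hsum

lemma eq_of_harmonic_of_homogeneous_real {g : R3 → ℝ} (hg : ContDiffOn ℝ 2 g {0}ᶜ)
    (hhom : ∀ x, x ≠ 0 → ∀ l : ℝ, 0 < l → g (l • x) = g x)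
    (hlap : ∀ x, x ≠ 0 → lap3 g x = 0) {x y : R3} (hx : x ≠ 0) (hy : y ≠ 0) : g x = g y := by
  have hconn : IsPreconnected ({0}ᶜ : Set R3) :=
    (isConnected_compl_singleton_of_one_lt_rank
      (by rw [← Module.finrank_eq_rank]; simp) 0).isPreconnected
  refine isOpen_compl_singleton.is_const_of_fderiv_eq_zero (𝕜 := ℝ) hconn
    (hg.differentiableOn (by simp)) (fun z hz => ?_) hx hy
  have h := fun j => pd_eq_zero_of_harmonic_of_homogeneous hg hhom hlap hz j
  ext w
  rw [clm_apply_eq_sum]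
  simp only [pd] at h
  simp [h]

lemma lap3_clm_comp {E F : Type*} [NormedAddCommGroup E] [NormedSpace ℝ E]
    [NormedAddCommGroup F] [NormedSpace ℝ F] (L : E →L[ℝ] F) {g : R3 → E} {x : R3}
    (hg : ContDiffAt ℝ 2 g x) : lap3 (fun y => L (g y)) x = L (lap3 g x) := by
  have key (i : Fin 3) : pd i (fun y => pd i (fun z => L (g z)) y) x
      = L (pd i (fun y => pd i g y) x) := by
    have h1 : (fun y => pd i (fun z => L (g z)) y) =ᶠ[𝓝 x] fun y => L (pd i g y) := by
      filter_upwards [hg.eventually (by simp)] with y hy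
      have := (L.hasFDerivAt.comp y (hy.differentiableAt (by simp)).hasFDerivAt).fderiv
      simp only [Function.comp_def] at this
      simp [pd, this]
    have h2 : ContDiffAt ℝ 1 (pd i g) x :=
      (hg.fderiv_right (m := 1) (by norm_num)).clm_apply contDiffAt_const
    have h3 := (L.hasFDerivAt.comp x (h2.differentiableAt (by simp)).hasFDerivAt).fderiv
    simp only [Function.comp_def] at h3
    rw [(pd_congr h1 i).eq_of_nhds]
    conv_lhs => rw [pd, h3]
    rfl
  simp only [lap3, key, map_add]

/-- A complex function on `ℝ³ \ {0}` which is homogeneous of degree zero and harmonic is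
constant. -/
lemma eq_of_harmonic_of_homogeneous {g : R3 → ℂ} (hg : ContDiffOn ℝ 2 g {0}ᶜ)
    (hhom : ∀ x, x ≠ 0 → ∀ l : ℝ, 0 < l → g (l • x) = g x)
    (hlap : ∀ x, x ≠ 0 → lap3 g x = 0) {x y : R3} (hx : x ≠ 0) (hy : y ≠ 0) : g x = g y := by
  have key (L : ℂ →L[ℝ] ℝ) : L (g x) = L (g y) := by
    refine eq_of_harmonic_of_homogeneous_real (g := fun z => L (g z))
      (L.contDiff.comp_contDiffOn hg) (fun z hz l hl => by rw [hhom z hz l hl])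
      (fun z hz => ?_) hx hy
    rw [lap3_clm_comp L (hg.contDiffAt (isOpen_compl_singleton.mem_nhds hz)), hlap z hz, map_zero]
  exact Complex.ext (key Complex.reCLM) (key Complex.imCLM)

/-- The derivative of a function depending on `y` only through `‖y‖` is radial in `y`. -/
lemma fderiv_norm_comp_radial {E : Type*} [NormedAddCommGroup E] [NormedSpace ℝ E]
    {V : ℝ × R3 → E} {p : R3 × R3} (hp : p.1 ≠ 0) (hV : DifferentiableAt ℝ V (‖p.1‖, p.2))
    (h : R3) :
    ‖p.1‖ ^ 2 • fderiv ℝ (fun q : R3 × R3 => V (‖q.1‖, q.2)) p (h, 0)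
      = inner ℝ p.1 h • fderiv ℝ (fun q : R3 × R3 => V (‖q.1‖, q.2)) p (p.1, 0) := by
  have hn : HasFDerivAt (fun y : R3 => ‖y‖) (fderiv ℝ (fun y : R3 => ‖y‖) p.1) p.1 :=
    ((contDiffAt_norm ℝ hp (n := 1)).differentiableAt (by simp)).hasFDerivAt
  have hsq : ∀ k : R3, ‖p.1‖ * fderiv ℝ (fun y : R3 => ‖y‖) p.1 k = inner ℝ p.1 k := by
    intro k
    have h2 := congrArg (fun L : R3 →L[ℝ] ℝ => L k)
      ((hn.pow 2).unique (hasStrictFDerivAt_norm_sq p.1).hasFDerivAt)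
    simp at h2
    linarith
  have hA : HasFDerivAt (fun q : R3 × R3 => (‖q.1‖, q.2))
      (((fderiv ℝ (fun y : R3 => ‖y‖) p.1).comp (ContinuousLinearMap.fst ℝ R3 R3)).prod
        (ContinuousLinearMap.snd ℝ R3 R3)) p :=
    (HasFDerivAt.comp p (f := Prod.fst) hn hasFDerivAt_fst).prodMk hasFDerivAt_snd
  have hW := (HasFDerivAt.comp p (f := fun q : R3 × R3 => (‖q.1‖, q.2)) hV.hasFDerivAt hA).fderiv
  simp only [Function.comp_def] at hW
  have hval : ∀ k : R3, fderiv ℝ (fun q : R3 × R3 => V (‖q.1‖, q.2)) p (k, 0)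
      = fderiv ℝ (fun y : R3 => ‖y‖) p.1 k • fderiv ℝ V (‖p.1‖, p.2) (1, 0) := by
    intro k
    rw [hW, ← map_smul]
    simp
  rw [hval, hval, smul_smul, smul_smul]
  congr 1
  have h1 := hsq p.1
  rw [real_inner_self_eq_norm_sq] at h1
  have h3 : fderiv ℝ (fun y : R3 => ‖y‖) p.1 p.1 = ‖p.1‖ := by
    have : ‖p.1‖ ≠ 0 := norm_ne_zero_iff.2 hp
    apply mul_left_cancel₀ this
    linarith
  rw [h3, ← hsq h]
  ring

end LaplacianLemmas

/-- **No modulated spherical wave solutions.**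
Let `I` be a nonempty open interval, `0 < a < b`, and let `v(t,r,ω)` be a smooth function
of `(t,r,ω) ∈ I × (a,b) × S²` (realized as a function of a third argument in `ℝ³ \ {0}`
invariant under positive scaling) such that for each fixed `ω ∈ S²` the function
`(t,x) ↦ v(t,|x|,ω)` satisfies the wave equation on `{t ∈ I, a < |x| < b}`.
Then `u(t,x) := v(t,|x|,x/|x|)` satisfies the wave equation there
if and only if `v` is independent of its angular argument. -/
theorem no_modulated_spherical_wave
    (I : Set ℝ) (hIopen : IsOpen I) (hIne : I.Nonempty) (hIconn : I.OrdConnected)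
    (a b : ℝ) (ha : 0 < a) (hab : a < b)
    (v : ℝ → ℝ → R3 → ℂ)
    (hsm : ∀ n : ℕ, ContDiffOn ℝ n (fun p : ℝ × ℝ × R3 => v p.1 p.2.1 p.2.2)
      (I ×ˢ (Set.Ioo a b) ×ˢ {x : R3 | x ≠ 0}))
    (hhom : ∀ t ∈ I, ∀ r ∈ Set.Ioo a b, ∀ x : R3, x ≠ 0 → ∀ l : ℝ, 0 < l →
      v t r (l • x) = v t r x)
    (hwave : ∀ ω : R3, ‖ω‖ = 1 → ∀ t ∈ I, ∀ x : R3, a < ‖x‖ → ‖x‖ < b →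
      waveOp (fun s y => v s ‖y‖ ω) t x = 0) :
    (∀ t ∈ I, ∀ x : R3, a < ‖x‖ → ‖x‖ < b →
      waveOp (fun s y => v s ‖y‖ (‖y‖⁻¹ • y)) t x = 0)
    ↔ (∀ t ∈ I, ∀ r ∈ Set.Ioo a b, ∀ ω ω' : R3, ‖ω‖ = 1 → ‖ω'‖ = 1 →
      v t r ω = v t r ω') := by
  have hne : ∀ x : R3, a < ‖x‖ → x ≠ 0 := fun x hx => norm_pos_iff.1 (ha.trans hx)
  have hunit : ∀ x : R3, x ≠ 0 → ‖‖x‖⁻¹ • x‖ = 1 := fun x hx => by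
    rw [norm_smul, norm_inv, norm_norm, inv_mul_cancel₀ (norm_ne_zero_iff.2 hx)]
  have hann : ∀ x : R3, a < ‖x‖ → ‖x‖ < b → ∀ᶠ y : R3 in nhds x, a < ‖y‖ ∧ ‖y‖ < b :=
    fun x h1 h2 => (continuous_norm.continuousAt.eventually_const_lt h1).and
      (continuous_norm.continuousAt.eventually_lt_const h2)
  have hiff : ∀ t ∈ I, ∀ x : R3, a < ‖x‖ → ‖x‖ < b →
      (waveOp (fun s y => v s ‖y‖ (‖y‖⁻¹ • y)) t x = 0 ↔
        lap3 (fun y => v t ‖y‖ (‖y‖⁻¹ • y)) x = lap3 (fun y => v t ‖y‖ (‖x‖⁻¹ • x)) x) := by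
    intro t ht x h1 h2
    have h3 := hwave _ (hunit x (hne x h1)) t ht x h1 h2
    rw [waveOp_eq, sub_eq_zero] at h3
    rw [waveOp_eq, sub_eq_zero, h3]
    exact eq_comm
  constructor
  · intro hu t ht r hr ω ω' hω hω'
    have hV : ∀ s ∈ Set.Ioo a b, ∀ z : R3, z ≠ 0 →
        ContDiffAt ℝ 2 (fun q : ℝ × R3 => v t q.1 q.2) (s, z) := by
      intro s hs z hz
      have h1 : ContDiffAt ℝ 2 (fun p : ℝ × ℝ × R3 => v p.1 p.2.1 p.2.2) (t, s, z) :=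
        (hsm 2).contDiffAt ((hIopen.prod (isOpen_Ioo.prod isOpen_ne)).mem_nhds ⟨ht, hs, hz⟩)
      exact ContDiffAt.comp (s, z) (f := fun q : ℝ × R3 => (t, q)) h1
        (contDiffAt_const.prodMk contDiffAt_id)
    have hg : ∀ s ∈ Set.Ioo a b, ∀ z : R3, z ≠ 0 → ContDiffAt ℝ 2 (v t s) z :=
      fun s hs z hz => ContDiffAt.comp z (f := fun y : R3 => (s, y)) (hV s hs z hz)
        (contDiffAt_const.prodMk contDiffAt_id)
    have hsphere : ∀ x : R3, ‖x‖ = r → lap3 (v t r) x = 0 := by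
      intro x hxr
      have hxa : a < ‖x‖ := hxr ▸ hr.1
      have hxb : ‖x‖ < b := hxr ▸ hr.2
      have hx0 := hne x hxa
      have hinv : 0 < ‖x‖⁻¹ := inv_pos.2 (norm_pos_iff.2 hx0)
      have h1 := (hiff t ht x hxa hxb).1 (hu t ht x hxa hxb)
      have h2 : lap3 (fun y => v t ‖y‖ (‖y‖⁻¹ • y)) x = lap3 (fun y => v t ‖y‖ y) x := by
        apply lap3_congr
        filter_upwards [hann x hxa hxb] with y hy
        exact hhom t ht _ hy y (hne y hy.1) _ (inv_pos.2 (ha.trans hy.1))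
      have h3 : lap3 (fun y => v t ‖y‖ (‖x‖⁻¹ • x)) x = lap3 (fun y => v t ‖y‖ x) x := by
        apply lap3_congr
        filter_upwards [hann x hxa hxb] with y hy
        exact hhom t ht _ hy x hx0 _ hinv
      have hnear : ∀ᶠ p : R3 × R3 in nhds (x, x), (a < ‖p.1‖ ∧ ‖p.1‖ < b) ∧ p.2 ≠ 0 :=
        (hann x hxa hxb).prod_nhds (isOpen_ne.eventually_mem hx0)
      have hWd : ∀ p : R3 × R3, a < ‖p.1‖ → ‖p.1‖ < b → p.2 ≠ 0 →
          ContDiffAt ℝ 2 (fun q : R3 × R3 => v t ‖q.1‖ q.2) p := by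
        intro p hp1 hp2 hp3
        exact ContDiffAt.comp p (f := fun q : R3 × R3 => (‖q.1‖, q.2))
          (hV _ ⟨hp1, hp2⟩ _ hp3) ((contDiffAt_fst.norm ℝ (hne _ hp1)).prodMk contDiffAt_snd)
      have hdiag := lap3_diagonal (W := fun q : R3 × R3 => v t ‖q.1‖ q.2) hx0
        (hWd (x, x) hxa hxb hx0) ?_ ?_
      · rw [h2, h3, hdiag] at h1
        rw [← hxr]
        exact add_eq_left.1 h1
      · filter_upwards [hnear] with p hp h
        exact fderiv_norm_comp_radial (V := fun q : ℝ × R3 => v t q.1 q.2) (hne _ hp.1.1)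
          ((hV _ hp.1 _ hp.2).differentiableAt (by simp)) h
      · filter_upwards [hnear] with p hp
        have hd := (hWd p hp.1.1 hp.1.2 hp.2).differentiableAt (by simp)
        have hd' := (HasFDerivAt.comp p.2 (f := fun z : R3 => (p.1, z)) hd.hasFDerivAt
          (hasFDerivAt_prodMk_right p.1 p.2))
        have he := fderiv_self_eq_zero hd'.differentiableAt
          (fun l hl => hhom t ht _ hp.1 p.2 hp.2 l hl)
        rw [hd'.fderiv] at he
        simpa using he
    have hω0 : ω ≠ 0 := norm_ne_zero_iff.1 (by rw [hω]; exact one_ne_zero)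
    have hω'0 : ω' ≠ 0 := norm_ne_zero_iff.1 (by rw [hω']; exact one_ne_zero)
    refine eq_of_harmonic_of_homogeneous
      (fun z hz => (hg r hr z hz).contDiffWithinAt) (hhom t ht r hr) (fun z hz => ?_) hω0 hω'0
    have hz' : 0 < ‖z‖ := norm_pos_iff.2 hz
    have hr0 : 0 < r := ha.trans hr.1
    rw [lap3_smul_of_homogeneous (hhom t ht r hr) hz (div_pos hr0 hz'), hsphere, smul_zero]
    rw [norm_smul, Real.norm_of_nonneg (div_pos hr0 hz').le, div_mul_cancel₀ _ hz'.ne']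
  · intro hind t ht x h1 h2
    rw [hiff t ht x h1 h2]
    apply lap3_congr
    filter_upwards [hann x h1 h2] with y hy
    exact hind t ht _ hy _ _ (hunit y (hne y hy.1)) (hunit x (hne x h1))
end
end

section
/- Let 0 < a < b and let e : (a,b) → ℝ³ be continuously differentiable. If the vector field x ↦ e(|x|) has zero divergence on the annulus {x ∈ ℝ³ : a < |x| < b}, then e is constant on (a,b). -/
noncomputable section

open Real Set MeasureTheory

/-- Away from the origin, the Euclidean norm has derivative `v ↦ ⟪x, v⟫ / ‖x‖`. -/
lemma hasFDerivAt_norm_of_ne_zero {E : Type*} [NormedAddCommGroup E] [InnerProductSpace ℝ E]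
    {x : E} (hx : x ≠ 0) : HasFDerivAt (fun y : E => ‖y‖) (‖x‖⁻¹ • innerSL ℝ x) x := by
  have h := ((hasStrictFDerivAt_norm_sq x).hasFDerivAt).sqrt (by simpa using hx)
  simp only [Real.sqrt_sq (norm_nonneg _)] at h
  convert h using 1
  ext v
  simp
  field_simp

/-- The partial derivatives of the components of a radial field. -/
lemma pd_radial_component {e : ℝ → R3} {x : R3} (hx : x ≠ 0)
    (he : DifferentiableAt ℝ e ‖x‖) (i j : Fin 3) :
    pd i (fun y => e ‖y‖ j) x = ‖x‖⁻¹ * x i * deriv e ‖x‖ j := by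
  have hj : HasDerivAt (fun t => e t j) (deriv e ‖x‖ j) ‖x‖ :=
    (EuclideanSpace.proj j : R3 →L[ℝ] ℝ).hasFDerivAt.comp_hasDerivAt _ he.hasDerivAt
  have h := hj.comp_hasFDerivAt x (hasFDerivAt_norm_of_ne_zero hx)
  have h' : HasFDerivAt (fun y => e ‖y‖ j) _ x := h
  rw [pd, h'.fderiv]
  simp [EuclideanSpace.inner_single_right]
  ring

/-- The divergence of a radial field. -/
lemma div3_radial {e : ℝ → R3} {x : R3} (hx : x ≠ 0) (he : DifferentiableAt ℝ e ‖x‖) :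
    div3 (fun y => e ‖y‖) x = ‖x‖⁻¹ * ∑ i, x i * deriv e ‖x‖ i := by
  simp only [div3, pd_radial_component hx he, Fin.sum_univ_three]
  ring

/-- If `e : (a,b) → ℝ³` is `C¹` and the radial field `x ↦ e(|x|)` is divergence free on
the annulus `{a < |x| < b}`, then `e` is constant. -/
theorem divergence_free_radial_constant
    (a b : ℝ) (ha : 0 < a) (hab : a < b) (e : ℝ → R3)
    (he : ContDiffOn ℝ 1 e (Set.Ioo a b))
    (hdiv : ∀ x : R3, a < ‖x‖ → ‖x‖ < b → div3 (fun y => e ‖y‖) x = 0) :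
    ∀ r ∈ Set.Ioo a b, ∀ s ∈ Set.Ioo a b, e r = e s := by
  have hd : ∀ r ∈ Set.Ioo a b, DifferentiableAt ℝ e r := fun r hr =>
    (he.differentiableOn one_ne_zero).differentiableAt (isOpen_Ioo.mem_nhds hr)
  intro r hr s hs
  refine isOpen_Ioo.is_const_of_deriv_eq_zero isPreconnected_Ioo
    (he.differentiableOn one_ne_zero) (fun t ht => ?_) hr hs
  have ht0 : 0 < t := ha.trans ht.1
  ext i
  have hn : ‖(EuclideanSpace.single i t : R3)‖ = t := by
    simp [abs_of_pos ht0]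
  have hx : (EuclideanSpace.single i t : R3) ≠ 0 := by
    rw [← norm_ne_zero_iff, hn]
    exact ht0.ne'
  have h := hdiv (EuclideanSpace.single i t) (by rw [hn]; exact ht.1) (by rw [hn]; exact ht.2)
  rw [div3_radial hx (by rw [hn]; exact hd t ht), hn] at h
  simpa [PiLp.single_apply, ht0.ne'] using h
end
end

section
/- Let h : ℝ → ℝ be smooth with h⁽ᵏ⁾ ∈ L¹([0,∞)) for every k ≥ 0. Then the fields E, B defined from h are smooth on ℝ × (ℝ³ \ {0}) and satisfy there the full Maxwell system: ∂ₜE = curl B, ∂ₜB = −curl E, and div E = div B = 0 (curl and div acting in the spatial variable x). -/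
noncomputable section

open Real Set MeasureTheory

/-- The electric field built from the profile `h`:
`E(t,x) = (h''(s)/|x| − h'(s)/|x|²) (n × e₁)` with `s = |x|+t`, `n = x/|x|`. -/
def Efield (h : ℝ → ℝ) (t : ℝ) (x : R3) : R3 :=
  (deriv (deriv h) (‖x‖ + t) / ‖x‖ - deriv h (‖x‖ + t) / ‖x‖ ^ 2) •
    cross3 (‖x‖⁻¹ • x) e1

/-- The magnetic field built from the profile `h`:
`B(t,x) = −(h''(s)/|x| − 3h'(s)/|x|² + 3h(s)/|x|³)(n × (n × e₁)) + 2(h'(s)/|x|² − h(s)/|x|³) e₁`. -/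
def Bfield (h : ℝ → ℝ) (t : ℝ) (x : R3) : R3 :=
  -(deriv (deriv h) (‖x‖ + t) / ‖x‖ - 3 * deriv h (‖x‖ + t) / ‖x‖ ^ 2
      + 3 * h (‖x‖ + t) / ‖x‖ ^ 3) •
    cross3 (‖x‖⁻¹ • x) (cross3 (‖x‖⁻¹ • x) e1)
  + (2 * (deriv h (‖x‖ + t) / ‖x‖ ^ 2 - h (‖x‖ + t) / ‖x‖ ^ 3)) • e1

/-- The radial coefficient of `Efield` with respect to the linear field `x × e₁`. -/
def electricCoeff (h : ℝ → ℝ) (t r : ℝ) : ℝ :=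
  deriv (deriv h) (r + t) / r ^ 2 - deriv h (r + t) / r ^ 3

/-- The radial coefficient of `Bfield` with respect to the quadratic field `-x × (x × e₁)`. -/
def magneticCoeff (h : ℝ → ℝ) (t r : ℝ) : ℝ :=
  deriv (deriv h) (r + t) / r ^ 3 - 3 * (deriv h (r + t) / r ^ 4) + 3 * (h (r + t) / r ^ 5)

/-- The radial coefficient of `Bfield` with respect to the constant field `e₁`. -/
def axialCoeff (h : ℝ → ℝ) (t r : ℝ) : ℝ :=
  2 * (deriv h (r + t) / r ^ 2 - h (r + t) / r ^ 3)

lemma Efield_zero (h : ℝ → ℝ) (t : ℝ) (x : R3) : Efield h t x 0 = 0 := by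
  simp [Efield, cross3, e1]

lemma Efield_one (h : ℝ → ℝ) (t : ℝ) (x : R3) :
    Efield h t x 1 = electricCoeff h t ‖x‖ * x 2 := by
  simp [Efield, cross3, e1, electricCoeff]
  ring

lemma Efield_two (h : ℝ → ℝ) (t : ℝ) (x : R3) :
    Efield h t x 2 = electricCoeff h t ‖x‖ * -x 1 := by
  simp [Efield, cross3, e1, electricCoeff]
  ring

lemma Bfield_zero (h : ℝ → ℝ) (t : ℝ) (x : R3) :
    Bfield h t x 0 = magneticCoeff h t ‖x‖ * (x 1 ^ 2 + x 2 ^ 2) + axialCoeff h t ‖x‖ := by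
  simp [Bfield, cross3, e1, magneticCoeff, axialCoeff]
  ring

lemma Bfield_one (h : ℝ → ℝ) (t : ℝ) (x : R3) :
    Bfield h t x 1 = magneticCoeff h t ‖x‖ * -(x 0 * x 1) := by
  simp [Bfield, cross3, e1, magneticCoeff]
  ring

lemma Bfield_two (h : ℝ → ℝ) (t : ℝ) (x : R3) :
    Bfield h t x 2 = magneticCoeff h t ‖x‖ * -(x 0 * x 2) := by
  simp [Bfield, cross3, e1, magneticCoeff]
  ring

lemma hasDerivAt_comp_add_div_pow {u : ℝ → ℝ} (hu : Differentiable ℝ u) (t : ℝ) (n : ℕ) {r : ℝ}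
    (hr : r ≠ 0) :
    HasDerivAt (fun ρ => u (ρ + t) / ρ ^ n)
      (deriv u (r + t) / r ^ n - n * u (r + t) / r ^ (n + 1)) r := by
  have h1 : HasDerivAt (fun ρ => u (ρ + t)) (deriv u (r + t)) r :=
    (hu (r + t)).hasDerivAt.comp_add_const r t
  refine (h1.div (hasDerivAt_pow n r) (pow_ne_zero n hr)).congr_deriv ?_
  rcases n with _ | n
  · simp
  · push_cast
    field_simp
    ring

lemma hasDerivAt_electricCoeff {h : ℝ → ℝ} (h1 : Differentiable ℝ (deriv h))
    (h2 : Differentiable ℝ (deriv (deriv h))) (t : ℝ) {r : ℝ} (hr : r ≠ 0) :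
    HasDerivAt (electricCoeff h t)
      (deriv (deriv (deriv h)) (r + t) / r ^ 2 - 3 * deriv (deriv h) (r + t) / r ^ 3
        + 3 * deriv h (r + t) / r ^ 4) r := by
  refine ((hasDerivAt_comp_add_div_pow h2 t 2 hr).sub
    (hasDerivAt_comp_add_div_pow h1 t 3 hr)).congr_deriv ?_
  push_cast
  ring

lemma hasDerivAt_magneticCoeff {h : ℝ → ℝ} (h0 : Differentiable ℝ h)
    (h1 : Differentiable ℝ (deriv h))
    (h2 : Differentiable ℝ (deriv (deriv h))) (t : ℝ) {r : ℝ} (hr : r ≠ 0) :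
    HasDerivAt (magneticCoeff h t)
      (deriv (deriv (deriv h)) (r + t) / r ^ 3 - 6 * deriv (deriv h) (r + t) / r ^ 4
        + 15 * deriv h (r + t) / r ^ 5 - 15 * h (r + t) / r ^ 6) r := by
  refine (((hasDerivAt_comp_add_div_pow h2 t 3 hr).sub
    ((hasDerivAt_comp_add_div_pow h1 t 4 hr).const_mul 3)).add
    ((hasDerivAt_comp_add_div_pow h0 t 5 hr).const_mul 3)).congr_deriv ?_
  push_cast
  ring

lemma hasDerivAt_axialCoeff {h : ℝ → ℝ} (h0 : Differentiable ℝ h)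
    (h1 : Differentiable ℝ (deriv h)) (t : ℝ) {r : ℝ} (hr : r ≠ 0) :
    HasDerivAt (axialCoeff h t)
      (2 * (deriv (deriv h) (r + t) / r ^ 2 - 3 * deriv h (r + t) / r ^ 3
        + 3 * h (r + t) / r ^ 4)) r := by
  refine (((hasDerivAt_comp_add_div_pow h1 t 2 hr).sub
    (hasDerivAt_comp_add_div_pow h0 t 3 hr)).const_mul 2).congr_deriv ?_
  push_cast
  ring

lemma hasFDerivAt_norm_R3 {x : R3} (hx : x ≠ 0) :
    HasFDerivAt (fun y : R3 => ‖y‖) (‖x‖⁻¹ • innerSL ℝ x) x := by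
  have hr : ‖x‖ ^ 2 ≠ 0 := pow_ne_zero 2 (norm_ne_zero_iff.mpr hx)
  have h1 := (hasStrictFDerivAt_norm_sq x).hasFDerivAt.sqrt hr
  simp only [Real.sqrt_sq (norm_nonneg _)] at h1
  refine h1.congr_fderiv ?_
  ext v
  simp
  ring

lemma differentiableAt_radial {g : ℝ → ℝ} {g' : ℝ} {x : R3} (hx : x ≠ 0)
    (hg : HasDerivAt g g' ‖x‖) : DifferentiableAt ℝ (fun y : R3 => g ‖y‖) x :=
  (hg.comp_hasFDerivAt x (hasFDerivAt_norm_R3 hx)).differentiableAt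

lemma pd_radial {g : ℝ → ℝ} {g' : ℝ} {x : R3} (hx : x ≠ 0) (hg : HasDerivAt g g' ‖x‖)
    (i : Fin 3) : pd i (fun y => g ‖y‖) x = g' * (x i / ‖x‖) := by
  have h1 := (hg.comp_hasFDerivAt x (hasFDerivAt_norm_R3 hx)).fderiv
  simp only [Function.comp_def] at h1
  rw [pd, h1]
  simp [EuclideanSpace.inner_single_right, div_eq_inv_mul]

lemma pd_mul {f p : R3 → ℝ} {x : R3} (hf : DifferentiableAt ℝ f x) (hp : DifferentiableAt ℝ p x)
    (i : Fin 3) : pd i (fun y => f y * p y) x = f x * pd i p x + pd i f x * p x := by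
  simp only [pd]
  rw [fderiv_fun_mul hf hp]
  simp
  ring

lemma pd_add {f p : R3 → ℝ} {x : R3} (hf : DifferentiableAt ℝ f x) (hp : DifferentiableAt ℝ p x)
    (i : Fin 3) : pd i (fun y => f y + p y) x = pd i f x + pd i p x := by
  simp [pd, fderiv_fun_add hf hp]

lemma pd_neg (f : R3 → ℝ) (x : R3) (i : Fin 3) : pd i (fun y => -f y) x = -pd i f x := by
  simp [pd]

lemma pd_const (c : ℝ) (x : R3) (i : Fin 3) : pd i (fun _ => c) x = 0 := by
  simp [pd]

lemma pd_coord (x : R3) (i j : Fin 3) :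
    pd i (fun y => y j) x = if j = i then 1 else 0 := by
  have h1 : HasFDerivAt (fun y : R3 => y j) (EuclideanSpace.proj j : R3 →L[ℝ] ℝ) x :=
    (EuclideanSpace.proj j : R3 →L[ℝ] ℝ).hasFDerivAt
  rw [pd, h1.fderiv]
  simp

lemma pd_radial_mul {g : ℝ → ℝ} {g' : ℝ} {p : R3 → ℝ} {x : R3} (hx : x ≠ 0)
    (hg : HasDerivAt g g' ‖x‖) (hp : DifferentiableAt ℝ p x) (i : Fin 3) :
    pd i (fun y => g ‖y‖ * p y) x = g ‖x‖ * pd i p x + g' * (x i / ‖x‖) * p x := by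
  rw [pd_mul (differentiableAt_radial hx hg) hp, pd_radial hx hg]

lemma contDiffOn_comp_norm_add_div_pow {u : ℝ → ℝ} {n : ℕ} (hu : ContDiff ℝ n u) (k : ℕ) :
    ContDiffOn ℝ n (fun p : ℝ × R3 => u (‖p.2‖ + p.1) / ‖p.2‖ ^ k)
      (Set.univ ×ˢ {x : R3 | x ≠ 0}) := by
  have hn : ContDiffOn ℝ n (fun p : ℝ × R3 => ‖p.2‖) (Set.univ ×ˢ {x : R3 | x ≠ 0}) :=
    contDiffOn_snd.norm ℝ fun p hp => hp.2
  exact (hu.comp_contDiffOn (hn.add contDiffOn_fst)).div (hn.pow k)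
    fun p hp => pow_ne_zero k (norm_ne_zero_iff.mpr hp.2)

lemma contDiff_coord_snd {n : ℕ} (i : Fin 3) : ContDiff ℝ n (fun p : ℝ × R3 => p.2 i) :=
  (EuclideanSpace.proj i : R3 →L[ℝ] ℝ).contDiff.comp contDiff_snd

lemma contDiffOn_Efield {h : ℝ → ℝ} {n : ℕ} (h1 : ContDiff ℝ n (deriv h))
    (h2 : ContDiff ℝ n (deriv (deriv h))) :
    ContDiffOn ℝ n (fun p : ℝ × R3 => Efield h p.1 p.2) (Set.univ ×ˢ {x : R3 | x ≠ 0}) := by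
  have ha : ContDiffOn ℝ n (fun p : ℝ × R3 => electricCoeff h p.1 ‖p.2‖)
      (Set.univ ×ˢ {x : R3 | x ≠ 0}) :=
    (contDiffOn_comp_norm_add_div_pow h2 2).sub (contDiffOn_comp_norm_add_div_pow h1 3)
  have hc (i : Fin 3) := (contDiff_coord_snd (n := n) i).contDiffOn
    (s := Set.univ ×ˢ {x : R3 | x ≠ 0})
  rw [contDiffOn_euclidean]
  intro i
  fin_cases i
  · simpa only [Fin.zero_eta, Efield_zero] using contDiffOn_const
  · simpa only [Fin.mk_one, Efield_one] using ha.mul (hc 2)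
  · simpa only [Fin.reduceFinMk, Efield_two] using ha.mul (hc 1).neg

lemma contDiffOn_Bfield {h : ℝ → ℝ} {n : ℕ} (h0 : ContDiff ℝ n h) (h1 : ContDiff ℝ n (deriv h))
    (h2 : ContDiff ℝ n (deriv (deriv h))) :
    ContDiffOn ℝ n (fun p : ℝ × R3 => Bfield h p.1 p.2) (Set.univ ×ˢ {x : R3 | x ≠ 0}) := by
  have hm : ContDiffOn ℝ n (fun p : ℝ × R3 => magneticCoeff h p.1 ‖p.2‖)
      (Set.univ ×ˢ {x : R3 | x ≠ 0}) :=
    ((contDiffOn_comp_norm_add_div_pow h2 3).sub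
      (contDiffOn_const.mul (contDiffOn_comp_norm_add_div_pow h1 4))).add
      (contDiffOn_const.mul (contDiffOn_comp_norm_add_div_pow h0 5))
  have ha : ContDiffOn ℝ n (fun p : ℝ × R3 => axialCoeff h p.1 ‖p.2‖)
      (Set.univ ×ˢ {x : R3 | x ≠ 0}) :=
    contDiffOn_const.mul
      ((contDiffOn_comp_norm_add_div_pow h1 2).sub (contDiffOn_comp_norm_add_div_pow h0 3))
  have hc (i : Fin 3) := (contDiff_coord_snd (n := n) i).contDiffOn
    (s := Set.univ ×ˢ {x : R3 | x ≠ 0})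
  rw [contDiffOn_euclidean]
  intro i
  fin_cases i
  · simpa only [Fin.zero_eta, Bfield_zero] using
      (hm.mul (((hc 1).pow 2).add ((hc 2).pow 2))).add ha
  · simpa only [Fin.mk_one, Bfield_one] using hm.mul ((hc 0).mul (hc 1)).neg
  · simpa only [Fin.reduceFinMk, Bfield_two] using hm.mul ((hc 0).mul (hc 2)).neg

lemma deriv_Efield {h : ℝ → ℝ} (h1 : Differentiable ℝ (deriv h))
    (h2 : Differentiable ℝ (deriv (deriv h))) (t : ℝ) (x : R3) :
    deriv (fun s => Efield h s x) t = Efield (deriv h) t x := by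
  have d {u : ℝ → ℝ} (hu : Differentiable ℝ u) :
      HasDerivAt (fun s => u (‖x‖ + s)) (deriv u (‖x‖ + t)) t :=
    (hu _).hasDerivAt.comp_const_add _ _
  exact ((((d h2).div_const _).sub ((d h1).div_const _)).smul_const _).deriv

lemma deriv_Bfield {h : ℝ → ℝ} (h0 : Differentiable ℝ h) (h1 : Differentiable ℝ (deriv h))
    (h2 : Differentiable ℝ (deriv (deriv h))) (t : ℝ) (x : R3) :
    deriv (fun s => Bfield h s x) t = Bfield (deriv h) t x := by
  have d {u : ℝ → ℝ} (hu : Differentiable ℝ u) :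
      HasDerivAt (fun s => u (‖x‖ + s)) (deriv u (‖x‖ + t)) t :=
    (hu _).hasDerivAt.comp_const_add _ _
  exact ((((((d h2).div_const _).sub (((d h1).const_mul 3).div_const _)).add
    (((d h0).const_mul 3).div_const _)).neg.smul_const _).add
    (((((d h1).div_const _).sub ((d h0).div_const _)).const_mul 2).smul_const _)).deriv

lemma norm_sq_R3 (x : R3) : ‖x‖ ^ 2 = x 0 ^ 2 + x 1 ^ 2 + x 2 ^ 2 := by
  simp [EuclideanSpace.norm_sq_eq, Fin.sum_univ_three]

section PartialDerivatives

variable {h : ℝ → ℝ} {t : ℝ} {x : R3}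

lemma pd_Efield_one (h1 : Differentiable ℝ (deriv h)) (h2 : Differentiable ℝ (deriv (deriv h)))
    (hx : x ≠ 0) (i : Fin 3) :
    pd i (fun y => Efield h t y 1) x = electricCoeff h t ‖x‖ * (if 2 = i then 1 else 0) +
      deriv (electricCoeff h t) ‖x‖ * (x i / ‖x‖) * x 2 := by
  have ha := (hasDerivAt_electricCoeff h1 h2 t (norm_ne_zero_iff.mpr hx)).differentiableAt
  simp only [Efield_one]
  rw [pd_radial_mul hx ha.hasDerivAt (by fun_prop), pd_coord]

lemma pd_Efield_two (h1 : Differentiable ℝ (deriv h)) (h2 : Differentiable ℝ (deriv (deriv h)))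
    (hx : x ≠ 0) (i : Fin 3) :
    pd i (fun y => Efield h t y 2) x = electricCoeff h t ‖x‖ * -(if 1 = i then 1 else 0) +
      deriv (electricCoeff h t) ‖x‖ * (x i / ‖x‖) * -x 1 := by
  have ha := (hasDerivAt_electricCoeff h1 h2 t (norm_ne_zero_iff.mpr hx)).differentiableAt
  simp only [Efield_two]
  rw [pd_radial_mul hx ha.hasDerivAt (by fun_prop), pd_neg, pd_coord]

lemma pd_Bfield_zero (h0 : Differentiable ℝ h) (h1 : Differentiable ℝ (deriv h))
    (h2 : Differentiable ℝ (deriv (deriv h))) (hx : x ≠ 0) (i : Fin 3) :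
    pd i (fun y => Bfield h t y 0) x =
      magneticCoeff h t ‖x‖ *
        (2 * x 1 * (if 1 = i then 1 else 0) + 2 * x 2 * (if 2 = i then 1 else 0)) +
      deriv (magneticCoeff h t) ‖x‖ * (x i / ‖x‖) * (x 1 ^ 2 + x 2 ^ 2) +
      deriv (axialCoeff h t) ‖x‖ * (x i / ‖x‖) := by
  have hr := norm_ne_zero_iff.mpr hx
  have hm := (hasDerivAt_magneticCoeff h0 h1 h2 t hr).differentiableAt.hasDerivAt
  have ha := (hasDerivAt_axialCoeff h0 h1 t hr).differentiableAt.hasDerivAt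
  simp only [Bfield_zero, sq]
  rw [pd_add ((differentiableAt_radial hx hm).fun_mul (by fun_prop))
      (differentiableAt_radial hx ha),
    pd_radial_mul hx hm (by fun_prop), pd_radial hx ha, pd_add (by fun_prop) (by fun_prop),
    pd_mul (by fun_prop) (by fun_prop), pd_mul (by fun_prop) (by fun_prop), pd_coord, pd_coord]
  ring

lemma pd_Bfield_one (h0 : Differentiable ℝ h) (h1 : Differentiable ℝ (deriv h))
    (h2 : Differentiable ℝ (deriv (deriv h))) (hx : x ≠ 0) (i : Fin 3) :
    pd i (fun y => Bfield h t y 1) x =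
      magneticCoeff h t ‖x‖ *
        -(x 0 * (if 1 = i then 1 else 0) + (if 0 = i then 1 else 0) * x 1) +
      deriv (magneticCoeff h t) ‖x‖ * (x i / ‖x‖) * -(x 0 * x 1) := by
  have hr := norm_ne_zero_iff.mpr hx
  have hm := (hasDerivAt_magneticCoeff h0 h1 h2 t hr).differentiableAt.hasDerivAt
  simp only [Bfield_one]
  rw [pd_radial_mul hx hm (by fun_prop), pd_neg, pd_mul (by fun_prop) (by fun_prop),
    pd_coord, pd_coord]

lemma pd_Bfield_two (h0 : Differentiable ℝ h) (h1 : Differentiable ℝ (deriv h))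
    (h2 : Differentiable ℝ (deriv (deriv h))) (hx : x ≠ 0) (i : Fin 3) :
    pd i (fun y => Bfield h t y 2) x =
      magneticCoeff h t ‖x‖ *
        -(x 0 * (if 2 = i then 1 else 0) + (if 0 = i then 1 else 0) * x 2) +
      deriv (magneticCoeff h t) ‖x‖ * (x i / ‖x‖) * -(x 0 * x 2) := by
  have hr := norm_ne_zero_iff.mpr hx
  have hm := (hasDerivAt_magneticCoeff h0 h1 h2 t hr).differentiableAt.hasDerivAt
  simp only [Bfield_two]
  rw [pd_radial_mul hx hm (by fun_prop), pd_neg, pd_mul (by fun_prop) (by fun_prop),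
    pd_coord, pd_coord]

lemma div3_Efield (h1 : Differentiable ℝ (deriv h)) (h2 : Differentiable ℝ (deriv (deriv h)))
    (hx : x ≠ 0) : div3 (Efield h t) x = 0 := by
  rw [div3, pd_Efield_one h1 h2 hx, pd_Efield_two h1 h2 hx]
  simp only [Efield_zero, pd_const]
  simp
  ring

lemma div3_Bfield (h0 : Differentiable ℝ h) (h1 : Differentiable ℝ (deriv h))
    (h2 : Differentiable ℝ (deriv (deriv h))) (hx : x ≠ 0) : div3 (Bfield h t) x = 0 := by
  have hr := norm_ne_zero_iff.mpr hx
  rw [div3, pd_Bfield_zero h0 h1 h2 hx, pd_Bfield_one h0 h1 h2 hx, pd_Bfield_two h0 h1 h2 hx,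
    (hasDerivAt_axialCoeff h0 h1 t hr).deriv]
  simp [magneticCoeff]
  field_simp
  ring

lemma curl3_Bfield (h0 : Differentiable ℝ h) (h1 : Differentiable ℝ (deriv h))
    (h2 : Differentiable ℝ (deriv (deriv h))) (hx : x ≠ 0) :
    curl3 (Bfield h t) x = Efield (deriv h) t x := by
  have hr := norm_ne_zero_iff.mpr hx
  have hs : x 0 ^ 2 = ‖x‖ ^ 2 - x 1 ^ 2 - x 2 ^ 2 := by rw [norm_sq_R3]; ring
  ext i
  fin_cases i
  · simp [curl3, Efield_zero, pd_Bfield_one h0 h1 h2 hx, pd_Bfield_two h0 h1 h2 hx]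
    ring
  · simp [curl3, Efield_one, pd_Bfield_zero h0 h1 h2 hx, pd_Bfield_two h0 h1 h2 hx,
      (hasDerivAt_axialCoeff h0 h1 t hr).deriv, (hasDerivAt_magneticCoeff h0 h1 h2 t hr).deriv,
      magneticCoeff, electricCoeff]
    field_simp
    ring_nf
    simp only [hs]
    ring
  · simp [curl3, Efield_two, pd_Bfield_zero h0 h1 h2 hx, pd_Bfield_one h0 h1 h2 hx,
      (hasDerivAt_axialCoeff h0 h1 t hr).deriv, (hasDerivAt_magneticCoeff h0 h1 h2 t hr).deriv,
      magneticCoeff, electricCoeff]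
    field_simp
    ring_nf
    simp only [hs]
    ring

lemma curl3_Efield (h1 : Differentiable ℝ (deriv h)) (h2 : Differentiable ℝ (deriv (deriv h)))
    (hx : x ≠ 0) : curl3 (Efield h t) x = -Bfield (deriv h) t x := by
  have hr := norm_ne_zero_iff.mpr hx
  have hp (i : Fin 3) : pd i (fun y => Efield h t y 0) x = 0 := by
    simp only [Efield_zero, pd_const]
  ext i
  fin_cases i
  · simp [curl3, Bfield_zero, pd_Efield_one h1 h2 hx, pd_Efield_two h1 h2 hx,
      (hasDerivAt_electricCoeff h1 h2 t hr).deriv, magneticCoeff, electricCoeff, axialCoeff]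
    field_simp
    ring
  · simp [curl3, Bfield_one, hp, pd_Efield_two h1 h2 hx,
      (hasDerivAt_electricCoeff h1 h2 t hr).deriv, magneticCoeff]
    field_simp
  · simp [curl3, Bfield_two, hp, pd_Efield_one h1 h2 hx,
      (hasDerivAt_electricCoeff h1 h2 t hr).deriv, magneticCoeff]
    field_simp

end PartialDerivatives

/-- **Theorem 3.1 (incoming solutions of Maxwell's equations).**
If `h` is smooth with all derivatives integrable on `[0,∞)`, then the fields `E`, `B`
built from `h` are smooth on `ℝ × (ℝ³ \ {0})` and satisfy the full Maxwell system
`∂ₜE = curl B`, `∂ₜB = −curl E`, `div E = div B = 0` there. -/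
theorem incoming_maxwell_solution (h : ℝ → ℝ)
    (hsm : ContDiff ℝ (⊤ : ℕ∞) h)
    (hint : ∀ k : ℕ, IntegrableOn (iteratedDeriv k h) (Set.Ici (0 : ℝ))) :
    (∀ n : ℕ, ContDiffOn ℝ n (fun p : ℝ × R3 => Efield h p.1 p.2)
        (Set.univ ×ˢ {x : R3 | x ≠ 0})) ∧
    (∀ n : ℕ, ContDiffOn ℝ n (fun p : ℝ × R3 => Bfield h p.1 p.2)
        (Set.univ ×ˢ {x : R3 | x ≠ 0})) ∧
    (∀ t : ℝ, ∀ x : R3, x ≠ 0 →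
      deriv (fun s => Efield h s x) t = curl3 (Bfield h t) x ∧
      deriv (fun s => Bfield h s x) t = - curl3 (Efield h t) x ∧
      div3 (Efield h t) x = 0 ∧
      div3 (Bfield h t) x = 0) := by
  have s1 : ContDiff ℝ (⊤ : ℕ∞) (deriv h) := (contDiff_infty_iff_deriv.mp hsm).2
  have s2 : ContDiff ℝ (⊤ : ℕ∞) (deriv (deriv h)) := (contDiff_infty_iff_deriv.mp s1).2
  have d0 : Differentiable ℝ h := (contDiff_infty_iff_deriv.mp hsm).1
  have d1 : Differentiable ℝ (deriv h) := (contDiff_infty_iff_deriv.mp s1).1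
  have d2 : Differentiable ℝ (deriv (deriv h)) := (contDiff_infty_iff_deriv.mp s2).1
  refine ⟨fun n => contDiffOn_Efield (contDiff_infty.mp s1 n) (contDiff_infty.mp s2 n),
    fun n => contDiffOn_Bfield (contDiff_infty.mp hsm n) (contDiff_infty.mp s1 n)
      (contDiff_infty.mp s2 n), fun t x hx => ⟨?_, ?_, ?_, ?_⟩⟩
  · rw [deriv_Efield d1 d2, curl3_Bfield d0 d1 d2 hx]
  · rw [deriv_Bfield d0 d1 d2, curl3_Efield d1 d2 hx, neg_neg]
  · exact div3_Efield d1 d2 hx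
  · exact div3_Bfield d0 d1 d2 hx
end
end
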